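/- Pointwise correspondence energy identity for the solid skeleton: let σ be a symmetric 3×3 real matrix (the effective Cauchy stress), let the velocity state Ẏ : ℝ³ → ℝ³ be measurable with ζ ↦ ω(ζ)‖Ẏ(ζ)‖‖ζ‖ integrable on H, and suppose the shape tensor K is invertible. Define the nonlocal velocity gradient L = (∫_H ω(ζ) (Ẏ(ζ) ⊗ ζ) dζ) K⁻¹, the rate of deformation D = (L + Lᵀ)/2, and the effective force state T(ζ) = ω(ζ) σ K⁻¹ ζ. Then the stress power equals the peridynamic internal power: tr(σ D) = ∫_H ⟨T(ζ), Ẏ(ζ)⟩ dζ. -/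

import Mathlib

open MeasureTheory Matrix

/-- If `‖V‖ ‖ζ‖` is integrable against a nonnegative weight, so is every entry of `V ⊗ ζ`. -/
lemma integrable_weight_mul_coord_mul_coord {ι : Type*} [Fintype ι]
    {μ : Measure (EuclideanSpace ℝ ι)} {ω : EuclideanSpace ℝ ι → ℝ}
    {V : EuclideanSpace ℝ ι → EuclideanSpace ℝ ι}
    (hω : Measurable ω) (hω_nonneg : ∀ ζ, 0 ≤ ω ζ) (hV : Measurable V)
    (h : Integrable (fun ζ => ω ζ * ‖V ζ‖ * ‖ζ‖) μ) (i j : ι) :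
    Integrable (fun ζ => ω ζ * V ζ i * ζ j) μ := by
  have hcoord (k : ι) : Measurable fun ζ : EuclideanSpace ℝ ι => ζ k :=
    (EuclideanSpace.proj (𝕜 := ℝ) k).continuous.measurable
  refine h.mono' ((hω.mul ((hcoord i).comp hV)).mul (hcoord j)).aestronglyMeasurable
    (ae_of_all _ fun ζ => ?_)
  rw [norm_mul, norm_mul, Real.norm_of_nonneg (hω_nonneg ζ)]
  have hi := PiLp.norm_apply_le (V ζ) i
  have hj := PiLp.norm_apply_le ζ j
  have h0 := hω_nonneg ζ
  gcongr

/-- A symmetric matrix pairs with the symmetric part of a matrix as with the matrix itself. -/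
lemma Matrix.IsSymm.trace_mul_symmetricPart {n : Type*} [Fintype n] {S : Matrix n n ℝ}
    (hS : S.IsSymm) (A : Matrix n n ℝ) :
    (S * ((2⁻¹ : ℝ) • (A + Aᵀ))).trace = (S * A).trace := by
  have h : (S * Aᵀ).trace = (S * A).trace := by
    rw [← trace_transpose, transpose_mul, transpose_transpose, hS.eq, trace_mul_comm]
  rw [Matrix.mul_smul, trace_smul, Matrix.mul_add, trace_add, h, smul_eq_mul]
  ring

/-- Pointwise correspondence energy identity for the solid skeleton: the classical
stress power `tr(σ D)` equals the peridynamic internal power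
`∫_H ⟨T(ζ), Ẏ(ζ)⟩ dζ`, where `T(ζ) = ω(ζ) σ K⁻¹ ζ` is the effective force state. -/
theorem correspondence_energy_identity_solid
    (δ : ℝ) (hδ : 0 < δ)
    (ω : EuclideanSpace ℝ (Fin 3) → ℝ)
    (hωmeas : Measurable ω) (hωnn : ∀ ζ, 0 ≤ ω ζ)
    (hωint : IntegrableOn (fun ζ => ω ζ * ‖ζ‖ ^ 2)
      (Metric.closedBall (0 : EuclideanSpace ℝ (Fin 3)) δ))
    (σ : Matrix (Fin 3) (Fin 3) ℝ) (hσ : σ.IsSymm)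
    (V : EuclideanSpace ℝ (Fin 3) → EuclideanSpace ℝ (Fin 3)) (hVmeas : Measurable V)
    (hVint : IntegrableOn (fun ζ => ω ζ * ‖V ζ‖ * ‖ζ‖)
      (Metric.closedBall (0 : EuclideanSpace ℝ (Fin 3)) δ))
    (K : Matrix (Fin 3) (Fin 3) ℝ)
    (hK : ∀ i j, K i j =
      ∫ ζ in Metric.closedBall (0 : EuclideanSpace ℝ (Fin 3)) δ, ω ζ * ζ i * ζ j)
    (hKunit : IsUnit K)
    (L D : Matrix (Fin 3) (Fin 3) ℝ)
    (hL : L = (Matrix.of fun i j =>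
      ∫ ζ in Metric.closedBall (0 : EuclideanSpace ℝ (Fin 3)) δ, ω ζ * V ζ i * ζ j) * K⁻¹)
    (hD : D = (2⁻¹ : ℝ) • (L + Lᵀ))
    (T : EuclideanSpace ℝ (Fin 3) → Fin 3 → ℝ)
    (hT : ∀ ζ i, T ζ i = ω ζ * ∑ j, (σ * K⁻¹) i j * ζ j) :
    (σ * D).trace =
      ∫ ζ in Metric.closedBall (0 : EuclideanSpace ℝ (Fin 3)) δ, ∑ i, T ζ i * V ζ i := by
  have hKsymm : K.IsSymm := by
    ext i j
    rw [transpose_apply, hK, hK]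
    simp only [mul_right_comm]
  have hentry := integrable_weight_mul_coord_mul_coord hωmeas hωnn hVmeas hVint
  have hterm (i j : Fin 3) : Integrable (fun ζ => (σ * K⁻¹) i j * (ω ζ * V ζ i * ζ j))
      (volume.restrict (Metric.closedBall 0 δ)) :=
    (hentry i j).const_mul _
  have hpower (ζ : EuclideanSpace ℝ (Fin 3)) :
      ∑ i, T ζ i * V ζ i = ∑ i, ∑ j, (σ * K⁻¹) i j * (ω ζ * V ζ i * ζ j) := by
    simp only [hT, Finset.mul_sum, Finset.sum_mul]
    exact Finset.sum_congr rfl fun i _ => Finset.sum_congr rfl fun j _ => by ring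
  set M : Matrix (Fin 3) (Fin 3) ℝ := Matrix.of fun i j =>
    ∫ ζ in Metric.closedBall (0 : EuclideanSpace ℝ (Fin 3)) δ, ω ζ * V ζ i * ζ j with hM
  have htrace : (σ * (M * K⁻¹)).trace = (σ * K⁻¹ * Mᵀ).trace := by
    rw [← trace_transpose, transpose_mul, transpose_mul, transpose_nonsing_inv, hKsymm.eq,
      hσ.eq, trace_mul_comm, Matrix.mul_assoc]
  rw [hD, hσ.trace_mul_symmetricPart, hL, htrace]
  simp only [hpower]
  rw [integral_finsetSum _ fun i _ => integrable_finsetSum _ fun j _ => hterm i j]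
  simp only [trace, diag_apply, mul_apply (M := σ * K⁻¹), transpose_apply]
  refine Finset.sum_congr rfl fun i _ => ?_
  rw [integral_finsetSum _ fun j _ => hterm i j]
  simp only [integral_const_mul, hM, of_apply]
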